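/- Let 𝒢 = (V,E) be a finite connected graph whose automorphism group is nontrivial (i.e., there exists a bijection σ : V → V with σ ≠ id such that (i,j) ∈ E if and only if (σ(i),σ(j)) ∈ E), and let n ≥ 2. Then the ℂ-algebra A_aut(𝒢^{⊔n}) is noncommutative (there exist a,b with ab ≠ ba) and infinite dimensional as a ℂ-vector space. -/

import Mathlib

noncomputable section

/-- The graph relations (4.1)–(4.4) presenting the quantum automorphism algebra
`A_aut(𝒢)` of a finite graph `𝒢 = (V, E)`, as relations on the free algebra on the
generators `X_{ij}` (`i, j ∈ V`). -/
inductive GraphRel (V : Type) [Fintype V] [DecidableEq V] (E : Finset (V × V)) :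
    FreeAlgebra ℂ (V × V) → FreeAlgebra ℂ (V × V) → Prop
  | r1row (i j k : V) :
      GraphRel V E (FreeAlgebra.ι ℂ (i, j) * FreeAlgebra.ι ℂ (i, k))
        (if j = k then FreeAlgebra.ι ℂ (i, j) else 0)
  | r1col (i j k : V) :
      GraphRel V E (FreeAlgebra.ι ℂ (j, i) * FreeAlgebra.ι ℂ (k, i))
        (if j = k then FreeAlgebra.ι ℂ (j, i) else 0)
  | r1rowSum (i : V) : GraphRel V E (∑ l : V, FreeAlgebra.ι ℂ (i, l)) 1
  | r1colSum (i : V) : GraphRel V E (∑ l : V, FreeAlgebra.ι ℂ (l, i)) 1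
  | r2a (γ : V × V) (hγ : γ ∈ E) (i k : V) (h : (i, k) ∉ E) :
      GraphRel V E (FreeAlgebra.ι ℂ (γ.1, i) * FreeAlgebra.ι ℂ (γ.2, k)) 0
  | r2a' (γ : V × V) (hγ : γ ∈ E) (i k : V) (h : (i, k) ∉ E) :
      GraphRel V E (FreeAlgebra.ι ℂ (γ.2, k) * FreeAlgebra.ι ℂ (γ.1, i)) 0
  | r2b (γ : V × V) (hγ : γ ∈ E) (i k : V) (h : (i, k) ∉ E) :
      GraphRel V E (FreeAlgebra.ι ℂ (i, γ.1) * FreeAlgebra.ι ℂ (k, γ.2)) 0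
  | r2b' (γ : V × V) (hγ : γ ∈ E) (i k : V) (h : (i, k) ∉ E) :
      GraphRel V E (FreeAlgebra.ι ℂ (k, γ.2) * FreeAlgebra.ι ℂ (i, γ.1)) 0
  | r3 (γ γ' : V × V) (hγ : γ ∈ E) (hγ' : γ' ∈ E) :
      GraphRel V E (FreeAlgebra.ι ℂ (γ.1, γ'.1) * FreeAlgebra.ι ℂ (γ.2, γ'.2))
        (FreeAlgebra.ι ℂ (γ.2, γ'.2) * FreeAlgebra.ι ℂ (γ.1, γ'.1))
  | r4a (γ : V × V) (hγ : γ ∈ E) :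
      GraphRel V E (∑ γ' ∈ E, FreeAlgebra.ι ℂ (γ'.1, γ.1) * FreeAlgebra.ι ℂ (γ'.2, γ.2)) 1
  | r4b (γ : V × V) (hγ : γ ∈ E) :
      GraphRel V E (∑ γ' ∈ E, FreeAlgebra.ι ℂ (γ.1, γ'.1) * FreeAlgebra.ι ℂ (γ.2, γ'.2)) 1

/-- The quantum automorphism algebra `A_aut(𝒢)` of the finite graph `𝒢 = (V, E)`. -/
abbrev AAut (V : Type) [Fintype V] [DecidableEq V] (E : Finset (V × V)) : Type :=
  RingQuot (GraphRel V E)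

/-- The generators `X_{ij}` of `A_aut(𝒢)`. -/
def XA (V : Type) [Fintype V] [DecidableEq V] (E : Finset (V × V)) (i j : V) : AAut V E :=
  RingQuot.mkAlgHom ℂ (GraphRel V E) (FreeAlgebra.ι ℂ (i, j))

/-- The edge set of the `n`-fold disjoint union `𝒢^{⊔n}` of `𝒢 = (V, E)`, on the vertex
set `Fin n × V`. -/
def unionEdges (V : Type) [Fintype V] [DecidableEq V] (E : Finset (V × V)) (n : ℕ) :
    Finset ((Fin n × V) × (Fin n × V)) :=
  (Finset.univ ×ˢ E).image fun p => ((p.1, p.2.1), (p.1, p.2.2))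

/-- Adjacency (an edge traversed in either direction). -/
def Adj (V : Type) [Fintype V] [DecidableEq V] (E : Finset (V × V)) (u v : V) : Prop :=
  (u, v) ∈ E ∨ (v, u) ∈ E

section Helper
variable {W : Type} [Fintype W] [DecidableEq W] {B : Type} [Ring B] [Algebra ℂ B]

/-- Image of the generators. -/
def gen (τ : W ≃ W) (e : W → B) (i j : W) : B :=
  (if i = j then e i else 0) + (if τ i = j then 1 - e i else 0)

theorem gen_col (τ : W ≃ W) (e : W → B) (hτ : ∀ i, e (τ i) = e i) (i j : W) :
    gen τ e i j = (if i = j then e j else 0) + (if τ i = j then 1 - e j else 0) := by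
  unfold gen
  congr 1
  · split_ifs with h
    · rw [h]
    · rfl
  · split_ifs with h
    · rw [← h, hτ]
    · rfl

theorem aux_mul (p : B) (hp : p * p = p) (P Q P' Q' : Prop) [Decidable P] [Decidable Q]
    [Decidable P'] [Decidable Q'] :
    ((if P then p else 0) + (if Q then 1 - p else 0)) *
      ((if P' then p else 0) + (if Q' then 1 - p else 0)) =
    (if P ∧ P' then p else 0) + (if Q ∧ Q' then 1 - p else 0) := by
  have h1 : p * (1 - p) = 0 := by rw [mul_sub, hp, mul_one, sub_self]
  have h2 : (1 - p) * p = 0 := by rw [sub_mul, hp, one_mul, sub_self]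
  have h3 : (1 - p) * (1 - p) = 1 - p := by rw [mul_sub, h2, mul_one, sub_zero]
  by_cases P <;> by_cases Q <;> by_cases P' <;> by_cases Q' <;>
    simp_all only [mul_add, add_mul, if_true, if_false, and_true, and_false, true_and, false_and, zero_add,
      add_zero, mul_zero, zero_mul]

theorem gen_mul_row (τ : W ≃ W) (e : W → B) (he : ∀ i, e i * e i = e i) (i j k l : W)
    (h : e i = e k) : gen τ e i j * gen τ e k l =
      (if i = j ∧ k = l then e i else 0) + (if τ i = j ∧ τ k = l then 1 - e i else 0) := by
  unfold gen
  rw [← h]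
  exact aux_mul _ (he i) _ _ _ _

theorem gen_mul_col (τ : W ≃ W) (e : W → B) (hτ : ∀ i, e (τ i) = e i)
    (he : ∀ i, e i * e i = e i) (i j k l : W)
    (h : e j = e l) : gen τ e i j * gen τ e k l =
      (if i = j ∧ k = l then e j else 0) + (if τ i = j ∧ τ k = l then 1 - e j else 0) := by
  rw [gen_col τ e hτ, gen_col τ e hτ, ← h]
  exact aux_mul _ (he j) _ _ _ _

theorem gen_rel (F : Finset (W × W)) (τ : W ≃ W) (e : W → B) (hτ : ∀ i, e (τ i) = e i)
    (he : ∀ i, e i * e i = e i) (hF : ∀ i j, (i, j) ∈ F → e i = e j)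
    (hτF : ∀ i j, (i, j) ∈ F ↔ (τ i, τ j) ∈ F) (x y : FreeAlgebra ℂ (W × W))
    (h : GraphRel W F x y) :
    FreeAlgebra.lift ℂ (fun p : W × W => gen τ e p.1 p.2) x =
      FreeAlgebra.lift ℂ (fun p : W × W => gen τ e p.1 p.2) y := by
  induction h with
  | r1row i j k =>
    rw [apply_ite (FreeAlgebra.lift ℂ (fun p : W × W => gen τ e p.1 p.2))]
    simp only [map_mul, FreeAlgebra.lift_ι_apply, map_zero]
    rw [gen_mul_row τ e he _ _ _ _ rfl]
    unfold gen
    by_cases h : j = k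
    · simp [h]
    · rw [if_neg h, if_neg (fun h' => h (h'.1.symm.trans h'.2)),
        if_neg (fun h' => h (h'.1.symm.trans h'.2)), add_zero]
  | r1col i j k =>
    rw [apply_ite (FreeAlgebra.lift ℂ (fun p : W × W => gen τ e p.1 p.2))]
    simp only [map_mul, FreeAlgebra.lift_ι_apply, map_zero]
    rw [gen_mul_col τ e hτ he _ _ _ _ rfl, gen_col τ e hτ]
    by_cases h : j = k
    · simp [h]
    · rw [if_neg h, if_neg (fun h' => h (h'.1.trans h'.2.symm)),
        if_neg (fun h' => h (τ.injective (h'.1.trans h'.2.symm))), add_zero]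
  | r1rowSum i =>
    simp only [map_sum, FreeAlgebra.lift_ι_apply, map_one]
    simp [gen, Finset.sum_add_distrib]
  | r1colSum i =>
    simp only [map_sum, FreeAlgebra.lift_ι_apply, map_one]
    simp [gen_col τ e hτ, Finset.sum_add_distrib, ← Equiv.eq_symm_apply]
  | r2a γ hγ i k h =>
    simp only [map_mul, FreeAlgebra.lift_ι_apply, map_zero]
    rw [gen_mul_row τ e he _ _ _ _ (hF _ _ hγ), if_neg, if_neg, add_zero]
    · rintro ⟨rfl, rfl⟩; exact h ((hτF _ _).1 hγ)
    · rintro ⟨rfl, rfl⟩; exact h hγ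
  | r2a' γ hγ i k h =>
    simp only [map_mul, FreeAlgebra.lift_ι_apply, map_zero]
    rw [gen_mul_row τ e he _ _ _ _ (hF _ _ hγ).symm, if_neg, if_neg, add_zero]
    · rintro ⟨rfl, rfl⟩; exact h ((hτF _ _).1 hγ)
    · rintro ⟨rfl, rfl⟩; exact h hγ
  | r2b γ hγ i k h =>
    simp only [map_mul, FreeAlgebra.lift_ι_apply, map_zero]
    rw [gen_mul_col τ e hτ he _ _ _ _ (hF _ _ hγ), if_neg, if_neg, add_zero]
    · rintro ⟨h1, h2⟩; exact h ((hτF _ _).2 (by rw [h1, h2]; exact hγ))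
    · rintro ⟨rfl, rfl⟩; exact h hγ
  | r2b' γ hγ i k h =>
    simp only [map_mul, FreeAlgebra.lift_ι_apply, map_zero]
    rw [gen_mul_col τ e hτ he _ _ _ _ (hF _ _ hγ).symm, if_neg, if_neg, add_zero]
    · rintro ⟨h1, h2⟩; exact h ((hτF _ _).2 (by rw [h1, h2]; exact hγ))
    · rintro ⟨rfl, rfl⟩; exact h hγ
  | r3 γ γ' hγ hγ' =>
    simp only [map_mul, FreeAlgebra.lift_ι_apply]
    rw [gen_mul_row τ e he _ _ _ _ (hF _ _ hγ), gen_mul_row τ e he _ _ _ _ (hF _ _ hγ).symm,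
      hF _ _ hγ]
    simp only [and_comm]
  | r4a γ hγ =>
    simp only [map_sum, map_mul, FreeAlgebra.lift_ι_apply, map_one]
    have key : ∀ g ∈ F, gen τ e g.1 γ.1 * gen τ e g.2 γ.2 =
        (if g = γ then e γ.1 else 0) +
          (if g = (τ.symm γ.1, τ.symm γ.2) then 1 - e γ.1 else 0) := by
      intro g _
      rw [gen_mul_col τ e hτ he _ _ _ _ (hF _ _ hγ)]
      simp only [Prod.ext_iff, Equiv.eq_symm_apply]
    rw [Finset.sum_congr rfl key, Finset.sum_add_distrib, Finset.sum_ite_eq', Finset.sum_ite_eq',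
      if_pos hγ, if_pos, add_sub_cancel]
    rw [hτF]; simpa using hγ
  | r4b γ hγ =>
    simp only [map_sum, map_mul, FreeAlgebra.lift_ι_apply, map_one]
    have key : ∀ g ∈ F, gen τ e γ.1 g.1 * gen τ e γ.2 g.2 =
        (if γ = g then e γ.1 else 0) +
          (if (τ γ.1, τ γ.2) = g then 1 - e γ.1 else 0) := by
      intro g _
      rw [gen_mul_row τ e he _ _ _ _ (hF _ _ hγ)]
      simp only [Prod.ext_iff]
    rw [Finset.sum_congr rfl key, Finset.sum_add_distrib, Finset.sum_ite_eq, Finset.sum_ite_eq,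
      if_pos hγ, if_pos, add_sub_cancel]
    exact (hτF _ _).1 hγ

end Helper

open Polynomial in
theorem final_aux {A : Type} [Ring A] [Algebra ℂ A]
    (φ : A →ₐ[ℂ] Matrix (Fin 2) (Fin 2) ℂ[X]) (x y : A)
    (hx : φ x = !![1, 0; 0, 0]) (hy : φ y = !![X, X * (1 - X); 1, 1 - X]) :
    (∃ a b : A, a * b ≠ b * a) ∧ ¬ Module.Finite ℂ A := by
  constructor
  · refine ⟨x, y, fun h => ?_⟩
    have h2 := congrArg (fun a => φ a 1 0) h
    simp [hx, hy, Matrix.mul_apply, Fin.sum_univ_two] at h2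
  · intro hfin
    have hc : φ (x * y * x) = Matrix.diagonal ![X, 0] := by
      rw [map_mul, map_mul, hx, hy]
      ext i j
      fin_cases i <;> fin_cases j <;> simp [Matrix.mul_apply, Fin.sum_univ_two]
    have key : ∀ f : ℂ[X], φ (aeval (x * y * x) f) 0 0 = f := by
      intro f
      induction f using Polynomial.induction_on' with
      | add p q hp hq => rw [map_add, map_add, Matrix.add_apply, hp, hq]
      | monomial k a =>
        rw [aeval_monomial, ← Algebra.smul_def, map_smul, map_pow, hc, Matrix.diagonal_pow,
          Matrix.smul_apply, Matrix.diagonal_apply_eq]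
        simp [smul_eq_C_mul, C_mul_X_pow_eq_monomial]
    have hinj : Function.Injective (aeval (R := ℂ) (x * y * x)).toLinearMap := by
      intro f g h
      have h' : aeval (x * y * x) f = aeval (x * y * x) g := h
      rw [← key f, ← key g, h']
    exact Polynomial.not_finite (Module.Finite.of_injective _ hinj)

theorem exists_hom (V : Type) [Fintype V] [DecidableEq V] (E : Finset (V × V))
    (σ : V ≃ V) (hσE : ∀ i j : V, (i, j) ∈ E ↔ (σ i, σ j) ∈ E) (n : ℕ)
    (B : Type) [Ring B] [Algebra ℂ B] (p q : B) (hp : p * p = p) (hq : q * q = q)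
    (v : V) (hv : σ v ≠ v) (a b : Fin n) (hab : b ≠ a) :
    ∃ φ : AAut (Fin n × V) (unionEdges V E n) →ₐ[ℂ] B,
      φ (XA _ _ (a, v) (a, v)) = p ∧ φ (XA _ _ (b, v) (b, v)) = q := by
  let e : Fin n × V → B := fun w => if w.1 = a then p else q
  let τ : (Fin n × V) ≃ (Fin n × V) := Equiv.prodCongr (Equiv.refl _) σ
  have hmem : ∀ i j : Fin n × V, (i, j) ∈ unionEdges V E n ↔ i.1 = j.1 ∧ (i.2, j.2) ∈ E := by
    rintro ⟨i, i'⟩ ⟨j, j'⟩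
    simp only [unionEdges, Finset.mem_image, Finset.mem_product, Finset.mem_univ, true_and,
      Prod.exists, Prod.mk.injEq]
    constructor
    · rintro ⟨c, s, t, h, ⟨rfl, rfl⟩, rfl, rfl⟩
      exact ⟨rfl, h⟩
    · rintro ⟨rfl, h⟩
      exact ⟨i, i', j', h, ⟨rfl, rfl⟩, rfl, rfl⟩
  have hrel := gen_rel (unionEdges V E n) τ e (fun i => rfl)
    (fun i => by simp only [e]; split_ifs <;> assumption)
    (fun i j h => by simp only [e]; rw [((hmem i j).1 h).1])
    (fun i j => by rw [hmem, hmem, hσE]; rfl)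
  let φ : AAut (Fin n × V) (unionEdges V E n) →ₐ[ℂ] B :=
    RingQuot.liftAlgHom ℂ ⟨_, fun x y h => hrel x y h⟩
  have hφ : ∀ i j, φ (XA _ _ i j) = gen τ e i j := by
    intro i j
    simp only [φ, XA, RingQuot.liftAlgHom_mkAlgHom_apply, FreeAlgebra.lift_ι_apply]
  have hgen : ∀ c : Fin n, gen τ e (c, v) (c, v) = if c = a then p else q := by
    intro c
    simp [gen, τ, e, hv]
  refine ⟨φ, ?_, ?_⟩
  · rw [hφ, hgen, if_pos rfl]
  · rw [hφ, hgen, if_neg hab]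

open Polynomial in
theorem idem_p : (!![1, 0; 0, 0] : Matrix (Fin 2) (Fin 2) ℂ[X]) * !![1, 0; 0, 0] =
    !![1, 0; 0, 0] := by
  rw [Matrix.mul_fin_two]; simp

open Polynomial in
theorem idem_q : (!![X, X * (1 - X); 1, 1 - X] : Matrix (Fin 2) (Fin 2) ℂ[X]) *
    !![X, X * (1 - X); 1, 1 - X] = !![X, X * (1 - X); 1, 1 - X] := by
  rw [Matrix.mul_fin_two]
  congr 1
  funext i j
  fin_cases i <;> fin_cases j <;> simp <;> ring

/-- Let `𝒢 = (V, E)` be a finite connected graph with a nontrivial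
automorphism `σ`, and let `n ≥ 2`.  Then the `ℂ`-algebra `A_aut(𝒢^{⊔n})` is noncommutative
and infinite dimensional as a `ℂ`-vector space. -/
theorem stmt_18 (V : Type) [Fintype V] [DecidableEq V] (E : Finset (V × V))
    (hconn : ∀ u v : V, Relation.ReflTransGen (Adj V E) u v)
    (σ : V ≃ V) (hσ : σ ≠ Equiv.refl V)
    (hσE : ∀ i j : V, (i, j) ∈ E ↔ (σ i, σ j) ∈ E)
    (n : ℕ) (hn : 2 ≤ n) :
    (∃ a b : AAut (Fin n × V) (unionEdges V E n), a * b ≠ b * a) ∧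
    ¬ Module.Finite ℂ (AAut (Fin n × V) (unionEdges V E n)) := by
  obtain ⟨v, hv⟩ : ∃ v, σ v ≠ v := by
    by_contra! h
    exact hσ (Equiv.ext h)
  have hab : (⟨1, by omega⟩ : Fin n) ≠ ⟨0, by omega⟩ := by simp
  obtain ⟨φ, h1, h2⟩ := exists_hom V E σ hσE n _ _ _ idem_p idem_q v hv _ _ hab
  exact final_aux φ _ _ h1 h2
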